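/- Let q be an odd prime power. Then for each monic irreducible f(t) ∈ F_q[t] there exist a, b ∈ F_q(t) such that the quaternion algebra H(a,b) over F_q(t) is nonsplit exactly at the two places (f(t)) and ∞, i.e. (a,b)_{(f)} = (a,b)_∞ = -1 and (a,b)_q = 1 for all other places q of F_q(t). -/

import Mathlib

open Quaternion HahnSeries IsDedekindDomain Polynomial Multiplicative
noncomputable section

/-- The quaternion algebra `H(a,b)` over `K` splits. -/
def QuatSplits (K : Type) [Field K] (a b : K) : Prop :=
  Nonempty (ℍ[K, a, b] ≃ₐ[K] Matrix (Fin 2) (Fin 2) K)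

theorem quat_splits_of_norm (K : Type) [Field K] (h2 : (2 : K) ≠ 0) (a b x y : K) (ha : a ≠ 0)
    (hb : b ≠ 0) (h : x ^ 2 - a * y ^ 2 = b) : QuatSplits K a b := by
  let B : QuaternionAlgebra.Basis (Matrix (Fin 2) (Fin 2) K) a 0 b :=
    { i := !![0, a; 1, 0]
      j := !![x, -(a * y); y, -x]
      k := !![a * y, -(a * x); x, -(a * y)]
      i_mul_i := by ext i j; fin_cases i <;> fin_cases j <;> simp
      j_mul_j := by
        ext i j; fin_cases i <;> fin_cases j <;> simp <;>
          first | linear_combination h | linear_combination -h | ring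
      i_mul_j := by ext i j; fin_cases i <;> fin_cases j <;> simp
      j_mul_i := by ext i j; fin_cases i <;> fin_cases j <;> simp <;> ring }
  have hinj : Function.Injective B.liftHom := by
    rw [injective_iff_map_eq_zero]
    intro q hq
    have e00 := congrFun (congrFun hq 0) 0
    have e01 := congrFun (congrFun hq 0) 1
    have e10 := congrFun (congrFun hq 1) 0
    have e11 := congrFun (congrFun hq 1) 1
    simp [B, QuaternionAlgebra.Basis.lift, Matrix.algebraMap_matrix_apply] at e00 e01 e10 e11
    have hw : q.re = 0 := by
      have : 2 * q.re = 0 := by linear_combination e00 + e11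
      simpa [h2] using this
    have h1 : q.imJ * x + q.imK * (a * y) = 0 := by rw [hw] at e00; linear_combination e00
    have e01' : q.imI - q.imJ * y - q.imK * x = 0 := by
      have : a * (q.imI - q.imJ * y - q.imK * x) = 0 := by linear_combination e01
      simpa [ha] using this
    have hp : q.imI = 0 := by
      have : 2 * q.imI = 0 := by linear_combination e01' + e10
      simpa [h2] using this
    have h3 : q.imJ * y + q.imK * x = 0 := by rw [hp] at e10; linear_combination e10
    have hJ : q.imJ = 0 := by
      have : b * q.imJ = 0 := by linear_combination x * h1 - a * y * h3 - q.imJ * h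
      simpa [hb] using this
    have hK : q.imK = 0 := by
      have : b * q.imK = 0 := by linear_combination x * h3 - y * h1 - q.imK * h
      simpa [hb] using this
    ext <;> simp [*]
  have hfin : Module.finrank K ℍ[K, a, b] = Module.finrank K (Matrix (Fin 2) (Fin 2) K) := by
    rw [QuaternionAlgebra.finrank_eq_four, Module.finrank_matrix]
    simp
  have hbij : Function.Bijective B.liftHom :=
    ⟨hinj, (LinearMap.injective_iff_surjective_of_finrank_eq_finrank
      (f := B.liftHom.toLinearMap) hfin).1 hinj⟩
  exact ⟨AlgEquiv.ofBijective B.liftHom hbij⟩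

theorem quat_splits_of_square (K : Type) [Field K] (h2 : (2 : K) ≠ 0) (a b s : K) (ha : a ≠ 0)
    (hb : b ≠ 0) (h : s ^ 2 = a) : QuatSplits K a b := by
  have hs : s ≠ 0 := by rintro rfl; apply ha; rw [← h]; simp
  refine quat_splits_of_norm K h2 a b ((b + 1) / 2) ((b - 1) / (2 * s)) ha hb ?_
  rw [← h]; field_simp; ring

theorem quat_splits_symm (K : Type) [Field K] (a b : K) (h : QuatSplits K a b) :
    ∃ x y z w : K, (x ≠ 0 ∨ y ≠ 0 ∨ z ≠ 0 ∨ w ≠ 0) ∧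
      x ^ 2 - a * y ^ 2 = b * (z ^ 2 - a * w ^ 2) := by
  obtain ⟨e⟩ := h
  let E : Matrix (Fin 2) (Fin 2) K := !![0, 1; 0, 0]
  have hE : E * E = 0 := by ext i j; fin_cases i <;> fin_cases j <;> simp [E]
  have hE0 : E ≠ 0 := by
    intro h; have := congrFun (congrFun h 0) 1; simp [E] at this
  set q := e.symm E with hq
  have hq0 : q ≠ 0 := by simpa [hq] using hE0
  have hqq : q * q = 0 := by rw [hq, ← map_mul, hE, map_zero]
  have hne : q.re ≠ 0 ∨ q.imI ≠ 0 ∨ q.imJ ≠ 0 ∨ q.imK ≠ 0 := by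
    by_contra! hc
    apply hq0; ext <;> simp [hc]
  refine ⟨q.re, q.imI, q.imJ, q.imK, hne, ?_⟩
  have hN : (q.re ^ 2 - a * q.imI ^ 2 - b * (q.imJ ^ 2 - a * q.imK ^ 2)) • q = star q * (q * q) := by
    ext <;> simp <;> ring
  rw [hqq, mul_zero, smul_eq_zero] at hN
  rcases hN with hN | hN
  · linear_combination hN
  · exact absurd hN hq0

theorem norm_val {K : Type} [Field K] {Γ : Type*} [LinearOrderedCommMonoidWithZero Γ]
    (v : Valuation K Γ) (u : K) (hu : v u = 1)
    (hns : ∀ w : K, v w ≤ 1 → v (w ^ 2 - u) = 1) (x y : K) (h : x ≠ 0 ∨ y ≠ 0) :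
    ∃ s : K, s ≠ 0 ∧ v (x ^ 2 - u * y ^ 2) = v (s ^ 2) := by
  by_cases hy : y = 0
  · subst hy; exact ⟨x, by simpa using h, by simp⟩
  by_cases hxy : v (x / y) ≤ 1
  · refine ⟨y, hy, ?_⟩
    have : x ^ 2 - u * y ^ 2 = ((x / y) ^ 2 - u) * y ^ 2 := by field_simp
    rw [this, map_mul, hns _ hxy, one_mul]
  · have hx : x ≠ 0 := by rintro rfl; simp at hxy
    have hlt : v (u * (y / x) ^ 2) < 1 := by
      rw [map_mul, hu, one_mul, map_pow]
      have h1 : v (y / x) < 1 := by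
        by_contra hc
        push Not at hc hxy
        have h3 : v (x / y) * v (y / x) = 1 := by
          rw [← map_mul]; field_simp; simp
        have h4 : v (x / y) * 1 ≤ v (x / y) * v (y / x) := mul_le_mul_right hc _
        rw [h3, mul_one] at h4
        exact absurd hxy (not_lt.2 h4)
      exact pow_lt_one₀ zero_le h1 (by norm_num)
    refine ⟨x, hx, ?_⟩
    have : x ^ 2 - u * y ^ 2 = (1 - u * (y / x) ^ 2) * x ^ 2 := by field_simp
    rw [this, map_mul, Valuation.map_one_sub_of_lt v hlt, one_mul]

theorem not_splits_of_val (K : Type) [Field K] {Γ : Type*} [LinearOrderedCommMonoidWithZero Γ]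
    [Nontrivial Γ] [NoZeroDivisors Γ]
    (v : Valuation K Γ) (a b u t : K) (ht : t ≠ 0) (hat : a = u * t ^ 2) (hu : v u = 1)
    (hns : ∀ w : K, v w ≤ 1 → v (w ^ 2 - u) = 1)
    (hb : ∀ s : K, v b ≠ v (s ^ 2)) : ¬ QuatSplits K a b := by
  intro h
  obtain ⟨x, y, z, w, hne, heq⟩ := quat_splits_symm K a b h
  have hv0 : ∀ s : K, s ≠ 0 → v (s ^ 2) ≠ 0 := by
    intro s hs h0
    have : v (s ^ 2) * v ((s⁻¹) ^ 2) = 1 := by rw [← map_mul]; field_simp; simp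
    rw [h0, zero_mul] at this
    exact zero_ne_one this
  have key : ∀ x y : K, (x ≠ 0 ∨ y ≠ 0) → ∃ s : K, s ≠ 0 ∧ v (x ^ 2 - a * y ^ 2) = v (s ^ 2) := by
    intro x y hxy
    have := norm_val v u hu hns x (t * y) (by simpa [ht] using hxy)
    rw [hat]
    simpa [mul_pow, mul_assoc] using this
  by_cases hzw : z ≠ 0 ∨ w ≠ 0
  · obtain ⟨s, hs, hs'⟩ := key z w hzw
    by_cases hxy : x ≠ 0 ∨ y ≠ 0
    · obtain ⟨r, hr, hr'⟩ := key x y hxy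
      apply hb (r / s)
      have h1 : v (r ^ 2) = v b * v (s ^ 2) := by rw [← hr', heq, map_mul, hs']
      rw [div_pow, div_eq_mul_inv, map_mul, h1, mul_assoc, ← map_mul, mul_inv_cancel₀ (by simpa),
        map_one, mul_one]
    · push Not at hxy
      have h1 := congrArg v heq
      rw [hxy.1, hxy.2, map_mul, hs'] at h1
      simp only [ne_eq, OfNat.ofNat_ne_zero, not_false_eq_true, zero_pow, mul_zero, sub_self,
        map_zero] at h1
      have h2 : v b = 0 := by
        have := mul_eq_zero.1 h1.symm
        exact this.resolve_right (hv0 s hs)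
      exact hb 0 (by simp [h2])
  · have hxy : x ≠ 0 ∨ y ≠ 0 := by tauto
    obtain ⟨r, hr, hr'⟩ := key x y hxy
    push Not at hzw
    rw [heq, hzw.1, hzw.2] at hr'
    simp only [ne_eq, OfNat.ofNat_ne_zero, not_false_eq_true, zero_pow, mul_zero, sub_self,
        map_zero] at hr'
    exact hv0 r hr hr'.symm

open Filter Topology in
theorem tendsto_zero_of_v_le {K : Type} [Field K] [Valued K (WithZero (Multiplicative ℤ))]
    (x y : ℕ → K) (hxy : ∀ n, Valued.v (x n) = Valued.v (y n)) (hy : Tendsto y atTop (𝓝 0)) :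
    Tendsto x atTop (𝓝 0) := by
  rw [(Valued.hasBasis_nhds_zero _ _).tendsto_right_iff] at hy ⊢
  intro γ hγ
  filter_upwards [hy γ hγ] with n hn
  simp only [Valuation.restrict_lt_iff_lt_embedding] at hn ⊢
  rw [hxy]; exact hn

open Filter Topology in
theorem exists_sqrt_of_close {K : Type} [Field K] [Valued K (WithZero (Multiplicative ℤ))]
    [CompleteSpace K] (l : ℕ) [hl : Fact l.Prime] [CharP K l] (hodd : Odd l) (c : K)
    (hc : Valued.v (c - 1) < 1) : ∃ s : K, s ^ 2 = c := by
  set e := c - 1 with he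
  have hce : c = 1 + e := by rw [he]; ring
  have hvc : Valued.v c = 1 := by rw [hce, Valuation.map_one_add_of_lt _ hc]
  have hfrob : ∀ n, c ^ (l ^ n) = 1 + e ^ (l ^ n) := by
    intro n; rw [hce, add_pow_char_pow, one_pow]
  obtain ⟨m, hm⟩ := hodd
  have hen : Tendsto (fun n : ℕ => e ^ (l ^ n)) atTop (𝓝 0) :=
    (Valued.tendsto_zero_pow_of_v_lt_one hc).comp
      (tendsto_pow_atTop_atTop_of_one_lt hl.out.one_lt)
  have hodd' : ∀ n, Odd (l ^ n) := fun n => Odd.pow ⟨m, hm⟩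
  choose r hr using hodd'
  let s : ℕ → K := fun n => c ^ (r n + 1)
  have hss : ∀ n, s n ^ 2 = c * (1 + e ^ (l ^ n)) := by
    intro n
    rw [← hfrob, hr n]; simp only [s]; ring
  have hstep : ∀ n, s (n + 1) = s n * (1 + e ^ (l ^ n)) ^ m := by
    intro n
    rw [← hfrob, ← pow_mul, ← _root_.pow_add]
    have h1 := hr (n + 1)
    rw [pow_succ, hr n, hm] at h1
    rw [hr n]
    simp only [s]
    congr 1
    nlinarith
  have hsub : Tendsto (fun n => s (n + 1) - s n) atTop (𝓝 0) := by
    refine tendsto_zero_of_v_le _ (fun n => (1 + e ^ (l ^ n)) ^ m - 1) ?_ ?_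
    · intro n
      have : s (n + 1) - s n = s n * ((1 + e ^ (l ^ n)) ^ m - 1) := by rw [hstep]; ring
      rw [this, map_mul]
      simp [s, hvc]
    · have h1 : Tendsto (fun n => (1 + e ^ (l ^ n)) ^ m - 1) atTop (𝓝 ((1 + 0) ^ m - 1)) :=
        ((tendsto_const_nhds.add hen).pow m).sub tendsto_const_nhds
      simpa using h1
  have hna : NonarchimedeanAddGroup K := by
    refine ⟨fun U hU => ?_⟩
    obtain ⟨γ, hγ⟩ := Valued.mem_nhds_zero.1 hU
    exact ⟨⟨Valued.v.restrict.ltAddSubgroup γ, Valued.isOpen_ball _ _⟩, hγ⟩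
  have hcau := NonarchimedeanAddGroup.cauchySeq_of_tendsto_sub_nhds_zero hsub
  obtain ⟨t, ht⟩ := cauchySeq_tendsto_of_complete hcau
  refine ⟨t, ?_⟩
  have h1 : Tendsto (fun n => s n ^ 2) atTop (𝓝 (t ^ 2)) := ht.pow 2
  have h2 : Tendsto (fun n => s n ^ 2) atTop (𝓝 (c * (1 + 0))) := by
    simp_rw [hss]
    exact tendsto_const_nhds.mul (tendsto_const_nhds.add hen)
  have := tendsto_nhds_unique h1 h2
  simpa using this

section padic
variable {F : Type} [Field F] (p : HeightOneSpectrum F[X])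

/-- The embedding of polynomials in the completion. -/
def iotaP : F[X] →+* p.adicCompletion (RatFunc F) :=
  (algebraMap (RatFunc F) (p.adicCompletion (RatFunc F))).comp (algebraMap F[X] (RatFunc F))

theorem v_algebraMap (k : RatFunc F) :
    Valued.v (algebraMap (RatFunc F) (p.adicCompletion (RatFunc F)) k) = p.valuation _ k := by
  rw [← HeightOneSpectrum.valuedAdicCompletion_eq_valuation' p k]
  rfl

theorem v_iota (g : F[X]) : Valued.v (iotaP p g) = p.intValuation g := by
  rw [iotaP, RingHom.comp_apply, v_algebraMap, HeightOneSpectrum.valuation_of_algebraMap]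

theorem v_iota_le (g : F[X]) : Valued.v (iotaP p g) ≤ 1 := by
  rw [v_iota]; exact p.intValuation_le_one g

theorem v_iota_lt (g : F[X]) : Valued.v (iotaP p g) < 1 ↔ g ∈ p.asIdeal := by
  rw [v_iota]; exact p.intValuation_lt_one_iff_mem g

theorem v_iota_eq (g : F[X]) : Valued.v (iotaP p g) = 1 ↔ g ∉ p.asIdeal := by
  rw [← v_iota_lt, not_lt]
  exact ⟨fun h => h.ge, fun h => le_antisymm (v_iota_le p g) h⟩

theorem iota_inj : Function.Injective (iotaP p) :=
  (algebraMap (RatFunc F) (p.adicCompletion (RatFunc F))).injective.comp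
    (IsFractionRing.injective F[X] (RatFunc F))

theorem iota_ne_zero {g : F[X]} (hg : g ∉ p.asIdeal) : iotaP p g ≠ 0 := by
  intro h
  have := (v_iota_eq p g).2 hg
  rw [h] at this; simp at this

theorem approx (w : p.adicCompletion (RatFunc F)) (hw : Valued.v w ≤ 1) :
    ∃ g : F[X], Valued.v (w - iotaP p g) < 1 := by
  have hd := HeightOneSpectrum.denseRange_algebraMap (K := RatFunc F) p
  have hopen : {y : p.adicCompletion (RatFunc F) | Valued.v (w - y) < 1} ∈ nhds w := by
    rw [Valued.mem_nhds]
    refine ⟨1, ?_⟩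
    intro y hy
    simp only [Set.mem_ofPred_eq] at hy ⊢
    rw [Valuation.map_sub_swap]
    simpa using hy
  obtain ⟨k, hk⟩ := hd.exists_mem_open isOpen_interior ⟨w, mem_interior_iff_mem_nhds.2 hopen⟩
  have hk := interior_subset hk
  simp only [Set.mem_ofPred_eq] at hk
  have hk1 : p.valuation _ k ≤ 1 := by
    rw [← v_algebraMap]
    have := Valuation.map_sub Valued.v w (w - algebraMap (RatFunc F) (p.adicCompletion (RatFunc F)) k)
    rw [sub_sub_cancel] at this
    exact this.trans (max_le hw hk.le)
  obtain ⟨g, hg⟩ := HeightOneSpectrum.exists_valuation_sub_lt_of_integer p hk1 1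
  refine ⟨g, ?_⟩
  rw [← v_algebraMap, map_sub, Units.val_one] at hg
  have h3 : w - iotaP p g = (w - algebraMap _ _ k) -
      ((algebraMap (RatFunc F) (p.adicCompletion (RatFunc F)) (algebraMap F[X] (RatFunc F) g)) -
        algebraMap _ _ k) := by
    rw [iotaP, RingHom.comp_apply]; ring
  rw [h3]
  exact (Valuation.map_sub _ _ _).trans_lt (max_lt hk hg)

theorem nonsq_local (g : F[X]) (hns : ∀ w : F[X], w ^ 2 - g ∉ p.asIdeal)
    (w : p.adicCompletion (RatFunc F)) (hw : Valued.v w ≤ 1) :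
    Valued.v (w ^ 2 - iotaP p g) = 1 := by
  obtain ⟨h, hh⟩ := approx p w hw
  have e : w ^ 2 - iotaP p g = iotaP p (h ^ 2 - g) + (w - iotaP p h) * (w + iotaP p h) := by
    rw [map_sub, map_pow]; ring
  have h1 := (v_iota_eq p _).2 (hns h)
  have h2 : Valued.v (w + iotaP p h) ≤ 1 :=
    (Valuation.map_add _ _ _).trans (max_le hw (v_iota_le p h))
  have h3 : Valued.v ((w - iotaP p h) * (w + iotaP p h)) < 1 := by
    rw [map_mul]; exact mul_lt_one_of_lt_of_le hh h2
  rw [e, Valuation.map_add_eq_of_lt_left, h1]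
  rwa [h1]

variable [Fintype F]

theorem exists_char (hq : Odd (Fintype.card F)) : ∃ l : ℕ, l.Prime ∧ CharP F l ∧ Odd l := by
  obtain ⟨l, hl⟩ := CharP.exists F
  obtain ⟨n, hp, hn⟩ := FiniteField.card F l
  refine ⟨l, hp, hl, ?_⟩
  rw [hn] at hq
  exact (Nat.odd_pow_iff n.pos.ne').1 hq

theorem two_ne_zero_F (hq : Odd (Fintype.card F)) : (2 : F) ≠ 0 := by
  obtain ⟨l, hl, hc, ho⟩ := exists_char hq
  intro h
  have h1 : ((2 : ℕ) : F) = 0 := by exact_mod_cast h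
  rw [CharP.cast_eq_zero_iff F l] at h1
  have := (Nat.prime_dvd_prime_iff_eq hl Nat.prime_two).1 h1
  subst this
  exact absurd ho (by decide)

theorem two_ne_zero_P (hq : Odd (Fintype.card F)) : (2 : p.adicCompletion (RatFunc F)) ≠ 0 := by
  have h : iotaP p (C 2) ≠ 0 := by
    rw [map_ne_zero_iff _ (iota_inj p), Polynomial.C_ne_zero]
    exact two_ne_zero_F hq
  have : iotaP p (C 2) = 2 := by rw [map_ofNat, map_ofNat]
  rwa [this] at h

theorem sqrt_local (hq : Odd (Fintype.card F)) (g w : F[X]) (hg : g ∉ p.asIdeal)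
    (h : g - w ^ 2 ∈ p.asIdeal) : ∃ s, s ^ 2 = iotaP p g := by
  have hw : w ∉ p.asIdeal := by
    intro hw
    apply hg
    have := p.asIdeal.add_mem h (p.asIdeal.mul_mem_left w hw)
    convert this using 1; ring
  obtain ⟨l, hl, hc, ho⟩ := exists_char hq
  have : Fact l.Prime := ⟨hl⟩
  have : CharP (p.adicCompletion (RatFunc F)) l :=
    charP_of_injective_ringHom (f := (iotaP p).comp C) ((iota_inj p).comp C_injective) l
  have hw0 := iota_ne_zero p hw
  obtain ⟨s, hs⟩ := exists_sqrt_of_close l ho (iotaP p g / iotaP p w ^ 2) (by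
    have : iotaP p g / iotaP p w ^ 2 - 1 = iotaP p (g - w ^ 2) / iotaP p w ^ 2 := by
      rw [map_sub, map_pow]; field_simp
    rw [this, map_div₀, map_pow, (v_iota_eq p w).2 hw]
    simpa using (v_iota_lt p _).2 h)
  refine ⟨s * iotaP p w, ?_⟩
  rw [mul_pow, hs]; field_simp

theorem splits_of_sq (hq : Odd (Fintype.card F)) (g h w : F[X]) (hg : g ∉ p.asIdeal)
    (hh : h ≠ 0) (hw : g - w ^ 2 ∈ p.asIdeal) :
    QuatSplits (p.adicCompletion (RatFunc F)) (iotaP p g) (iotaP p h) := by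
  obtain ⟨s, hs⟩ := sqrt_local p hq g w hg hw
  exact quat_splits_of_square _ (two_ne_zero_P p hq) _ _ s (iota_ne_zero p hg)
    ((map_ne_zero_iff _ (iota_inj p)).2 hh) hs

theorem finite_sum {k : Type} [Field k] [Finite k] (hodd : Odd (Nat.card k)) (g h : k)
    (hg : g ≠ 0) : ∃ x y : k, x ^ 2 - g * y ^ 2 - h = 0 := by
  have := Fintype.ofFinite k
  rw [Nat.card_eq_fintype_card, Nat.odd_iff] at hodd
  obtain ⟨x, y, hxy⟩ := FiniteField.exists_root_sum_quadratic
    (f := (X ^ 2 : k[X])) (g := Polynomial.C (-g) * X ^ 2 + Polynomial.C 0 * X + Polynomial.C (-h))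
    (by rw [degree_X_pow]; rfl) (degree_quadratic (neg_ne_zero.2 hg)) hodd
  refine ⟨x, y, ?_⟩
  simp at hxy
  linear_combination hxy

theorem finite_quot (f : F[X]) (hf0 : f ≠ 0) : Finite (F[X] ⧸ Ideal.span {f}) := by
  have : Module.Finite F (F[X] ⧸ Ideal.span {f}) := (AdjoinRoot.powerBasis hf0).finite
  exact Module.finite_of_finite F

theorem residue_sum (hq : Odd (Fintype.card F)) (g h : F[X]) (hg : g ∉ p.asIdeal) :
    ∃ x y : F[X], x ^ 2 - g * y ^ 2 - h ∈ p.asIdeal := by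
  have := p.isMaximal
  obtain ⟨f, hf⟩ := IsPrincipalIdealRing.principal p.asIdeal
  have hf0 : f ≠ 0 := by
    rintro rfl
    apply p.ne_bot
    rw [hf]; simp
  have hfin : Finite (F[X] ⧸ p.asIdeal) := by
    rw [hf]; exact finite_quot f hf0
  have hodd : Odd (Nat.card (F[X] ⧸ p.asIdeal)) := by
    rw [Module.natCard_eq_pow_finrank (K := F), Nat.card_eq_fintype_card]
    exact hq.pow
  let _ : Field (F[X] ⧸ p.asIdeal) := Ideal.Quotient.field _
  obtain ⟨x, y, hxy⟩ := finite_sum hodd (Ideal.Quotient.mk p.asIdeal g)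
    (Ideal.Quotient.mk p.asIdeal h) (by rwa [Ne, Ideal.Quotient.eq_zero_iff_mem])
  obtain ⟨x, rfl⟩ := Ideal.Quotient.mk_surjective x
  obtain ⟨y, rfl⟩ := Ideal.Quotient.mk_surjective y
  refine ⟨x, y, ?_⟩
  rw [← Ideal.Quotient.eq_zero_iff_mem]
  simpa only [map_sub, map_mul, map_pow] using hxy

theorem splits_of_units (hq : Odd (Fintype.card F)) (g h : F[X]) (hg : g ∉ p.asIdeal)
    (hh : h ∉ p.asIdeal) :
    QuatSplits (p.adicCompletion (RatFunc F)) (iotaP p g) (iotaP p h) := by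
  obtain ⟨x, y, hxy⟩ := residue_sum p hq g h hg
  have := p.isPrime
  have h2 := two_ne_zero_P p hq
  by_cases hx : x ∈ p.asIdeal
  · -- `-g * h` is a square
    have hgy : -(g * h) - (g * y) ^ 2 ∈ p.asIdeal := by
      have h1 := p.asIdeal.sub_mem (p.asIdeal.mul_mem_left g hxy)
        (p.asIdeal.mul_mem_left (g * x) hx)
      convert h1 using 1; ring
    have hgh : -(g * h) ∉ p.asIdeal := by
      rw [neg_mem_iff]
      intro hc
      exact (p.isPrime.mem_or_mem hc).elim hg hh
    obtain ⟨s, hs⟩ := sqrt_local p hq _ _ hgh hgy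
    have hg0 := iota_ne_zero p hg
    refine quat_splits_of_norm _ h2 _ _ 0 (s / iotaP p g) hg0 (iota_ne_zero p hh) ?_
    rw [div_pow, hs, map_neg, map_mul]; field_simp; ring
  · have hx2 : h + g * y ^ 2 ∉ p.asIdeal := by
      intro hc
      apply hx
      apply p.isPrime.mem_of_pow_mem 2
      have := p.asIdeal.add_mem hxy hc
      convert this using 1; ring
    obtain ⟨s, hs⟩ := sqrt_local p hq _ x hx2 (by
      rw [← neg_mem_iff]; convert hxy using 1; ring)
    refine quat_splits_of_norm _ h2 _ _ s (iotaP p y) (iota_ne_zero p hg) (iota_ne_zero p hh) ?_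
    rw [hs, map_add, map_mul, map_pow]; ring

theorem v_uniformizer (f g : F[X]) (hf : f ≠ 0) (hp : p.asIdeal = Ideal.span {f})
    (hg : g ∉ p.asIdeal) (s : p.adicCompletion (RatFunc F)) :
    Valued.v (iotaP p (g * f)) ≠ Valued.v (s ^ 2) := by
  rw [map_mul, map_mul, (v_iota_eq p g).2 hg, one_mul, v_iota,
    p.intValuation_singleton hf hp, map_pow]
  intro h
  have hs : Valued.v s ≠ 0 := by
    intro h0; rw [h0] at h; simp at h
  have h1 := congrArg WithZero.log h
  rw [WithZero.log_pow, WithZero.log_exp] at h1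
  simp at h1
  omega

theorem nonsplit_local (f g a : F[X]) (hf : f ≠ 0) (hp : p.asIdeal = Ideal.span {f})
    (hg : g ∉ p.asIdeal) (ha : ∀ w : F[X], w ^ 2 - a ∉ p.asIdeal) :
    ¬ QuatSplits (p.adicCompletion (RatFunc F)) (iotaP p a) (iotaP p (g * f)) := by
  refine not_splits_of_val _ Valued.v _ _ (iotaP p a) 1 one_ne_zero (by simp) ?_
    (nonsq_local p a ha) (v_uniformizer p f g hf hp hg)
  rw [v_iota_eq]
  have := ha 0
  simpa using this
end padic

section infinity
variable {F : Type} [Field F] (φ : RatFunc F →+* LaurentSeries F)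

/-- The embedding of polynomials at infinity. -/
def psiI : F[X] →+* LaurentSeries F := φ.comp (algebraMap F[X] (RatFunc F))

theorem v_const (c : F) (hc : c ≠ 0) :
    Valued.v (HahnSeries.single (0 : ℤ) c : LaurentSeries F) = 1 := by
  have key : ∀ c : F, Valued.v (HahnSeries.single (0 : ℤ) c : LaurentSeries F) ≤ 1 := by
    intro c
    have h := (LaurentSeries.valuation_le_iff_coeff_lt_eq_zero F (D := 0)
      (f := (HahnSeries.single (0 : ℤ) c : LaurentSeries F))).2 (by
        intro n hn; exact HahnSeries.coeff_single_of_ne hn.ne)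
    simpa using h
  apply le_antisymm (key c)
  have h1 : (HahnSeries.single (0 : ℤ) c : LaurentSeries F) * HahnSeries.single (0 : ℤ) c⁻¹ = 1 := by
    rw [HahnSeries.single_mul_single, mul_inv_cancel₀ hc]; rfl
  have h2 := congrArg Valued.v h1
  rw [map_mul, map_one] at h2
  rw [← h2]
  exact mul_le_of_le_one_right' (key _)

theorem approx_inf (w : LaurentSeries F) (hw : Valued.v w ≤ 1) :
    ∃ c : F, Valued.v (w - HahnSeries.single (0 : ℤ) c) < 1 := by
  refine ⟨w.coeff 0, ?_⟩
  have h0 : Valued.v w ≤ WithZero.exp (-(0 : ℤ)) := by simpa using hw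
  rw [LaurentSeries.valuation_le_iff_coeff_lt_eq_zero] at h0
  have h := (LaurentSeries.valuation_le_iff_coeff_lt_eq_zero F (D := 1)
    (f := w - HahnSeries.single (0 : ℤ) (w.coeff 0))).2 (by
      intro n hn
      rw [HahnSeries.coeff_sub]
      by_cases hn0 : n = 0
      · subst hn0; simp
      · rw [HahnSeries.coeff_single_of_ne hn0, h0 n (by omega), sub_zero])
  refine h.trans_lt ?_
  rw [← WithZero.exp_zero, WithZero.exp_lt_exp]; norm_num

theorem psi_C
    (hφc : ∀ x : F, φ (algebraMap F (RatFunc F) x) = HahnSeries.single (0 : ℤ) x)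
    (c : F) : psiI φ (Polynomial.C c) = HahnSeries.single (0 : ℤ) c := by
  rw [← hφc, psiI, RingHom.comp_apply, RatFunc.algebraMap_C]; rfl

theorem v_psi_X
    (hφX : φ RatFunc.X * HahnSeries.single (1 : ℤ) (1 : F) = 1)
    : Valued.v (psiI φ X) = WithZero.exp (1 : ℤ) := by
  have h := congrArg Valued.v hφX
  rw [map_mul, LaurentSeries.valuation_single_zpow, map_one] at h
  rw [psiI, RingHom.comp_apply, RatFunc.algebraMap_X]
  rw [WithZero.exp_neg] at h
  exact (mul_inv_eq_one₀ (by simp)).1 h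

theorem v_psi_le
    (hφc : ∀ x : F, φ (algebraMap F (RatFunc F) x) = HahnSeries.single (0 : ℤ) x)
    (hφX : φ RatFunc.X * HahnSeries.single (1 : ℤ) (1 : F) = 1)
    (g : F[X]) (n : ℕ) (hn : g.natDegree ≤ n) :
    Valued.v (psiI φ g) ≤ WithZero.exp (n : ℤ) := by
  rw [g.as_sum_range_C_mul_X_pow, map_sum]
  refine Valuation.map_sum_le _ ?_
  intro i hi
  rw [map_mul, map_mul, psi_C φ hφc, map_pow, map_pow, v_psi_X φ hφX]
  by_cases hc : g.coeff i = 0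
  · simp [hc]
  · rw [v_const _ hc, one_mul, ← WithZero.exp_nsmul, WithZero.exp_le_exp]
    simp only [Finset.mem_range] at hi
    simp; omega

theorem v_psi_lt
    (hφc : ∀ x : F, φ (algebraMap F (RatFunc F) x) = HahnSeries.single (0 : ℤ) x)
    (hφX : φ RatFunc.X * HahnSeries.single (1 : ℤ) (1 : F) = 1)
    (g : F[X]) (n : ℕ) (hn : g.degree < n) :
    Valued.v (psiI φ g) < WithZero.exp (n : ℤ) := by
  by_cases hg : g = 0
  · subst hg; simp
  · have := (Polynomial.natDegree_lt_iff_degree_lt hg).2 hn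
    refine (v_psi_le φ hφc hφX g g.natDegree le_rfl).trans_lt ?_
    rw [WithZero.exp_lt_exp]; exact_mod_cast this

theorem v_psi
    (hφc : ∀ x : F, φ (algebraMap F (RatFunc F) x) = HahnSeries.single (0 : ℤ) x)
    (hφX : φ RatFunc.X * HahnSeries.single (1 : ℤ) (1 : F) = 1)
    (g : F[X]) (hg : g ≠ 0) :
    Valued.v (psiI φ g) = WithZero.exp (g.natDegree : ℤ) := by
  have h1 : Valued.v (psiI φ (Polynomial.C g.leadingCoeff * X ^ g.natDegree)) =
      WithZero.exp (g.natDegree : ℤ) := by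
    rw [map_mul, map_mul, psi_C φ hφc, map_pow, map_pow, v_psi_X φ hφX,
      v_const _ (leadingCoeff_ne_zero.2 hg), one_mul, ← WithZero.exp_nsmul]; simp
  have h2 : Valued.v (psiI φ g.eraseLead) < WithZero.exp (g.natDegree : ℤ) := by
    apply v_psi_lt φ hφc hφX
    rw [← degree_eq_natDegree hg]
    exact degree_eraseLead_lt hg
  have h3 : psiI φ g = psiI φ g.eraseLead +
      psiI φ (Polynomial.C g.leadingCoeff * X ^ g.natDegree) := by
    rw [← map_add, eraseLead_add_C_mul_X_pow]
  rw [h3, Valuation.map_add_eq_of_lt_right, h1]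
  rwa [h1]

theorem nonsplit_inf
    (hφc : ∀ x : F, φ (algebraMap F (RatFunc F) x) = HahnSeries.single (0 : ℤ) x)
    (hφX : φ RatFunc.X * HahnSeries.single (1 : ℤ) (1 : F) = 1)
    (z : F) (hz : ∀ x : F, x ^ 2 ≠ z) (a b : F[X]) (ha : a.leadingCoeff = z)
    (hae : Even a.natDegree) (hb : Odd b.natDegree) :
    ¬ QuatSplits (LaurentSeries F) (psiI φ a) (psiI φ b) := by
  have hz0 : z ≠ 0 := by intro h; exact hz 0 (by simp [h])
  have ha0 : a ≠ 0 := by rintro rfl; simp at ha; exact hz0 ha.symm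
  have hb0 : b ≠ 0 := by rintro rfl; simp at hb
  obtain ⟨m, hm⟩ := hae
  have hX : psiI φ X ≠ 0 := by
    intro h
    have := v_psi_X φ hφX
    rw [h, map_zero] at this; exact WithZero.exp_ne_zero this.symm
  have hXv : Valued.v (psiI φ X ^ (2 * m)) = WithZero.exp (a.natDegree : ℤ) := by
    rw [map_pow, v_psi_X φ hφX, ← WithZero.exp_nsmul]
    congr 1; simp; omega
  have hXm : psiI φ X ^ (2 * m) ≠ 0 := pow_ne_zero _ hX
  have hdiff : Valued.v (psiI φ a / psiI φ X ^ (2 * m) - HahnSeries.single (0 : ℤ) z) < 1 := by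
    have e : psiI φ a / psiI φ X ^ (2 * m) - HahnSeries.single (0 : ℤ) z =
        psiI φ a.eraseLead / psiI φ X ^ (2 * m) := by
      have : a.eraseLead = a - Polynomial.C z * X ^ (2 * m) := by
        rw [← ha, two_mul, ← hm, self_sub_C_mul_X_pow]
      rw [this, map_sub, map_mul, psi_C φ hφc, map_pow, eq_div_iff hXm, sub_mul,
        div_mul_cancel₀ _ hXm]
    rw [e, map_div₀, hXv]
    refine (div_lt_one₀ (by simp)).2 ?_
    apply v_psi_lt φ hφc hφX
    rw [← degree_eq_natDegree ha0]
    exact degree_eraseLead_lt ha0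
  refine not_splits_of_val _ Valued.v _ _ (psiI φ a / psiI φ X ^ (2 * m)) (psiI φ X ^ m)
    (pow_ne_zero _ hX) ?_ ?_ ?_ ?_
  · rw [← pow_mul, mul_comm m 2, div_mul_cancel₀ _ hXm]
  · rw [map_div₀, hXv, v_psi φ hφc hφX a ha0, div_self]; simp
  · intro w hw
    obtain ⟨c, hc⟩ := approx_inf w hw
    have h1 : Valued.v (HahnSeries.single (0 : ℤ) (c ^ 2 - z) : LaurentSeries F) = 1 :=
      v_const _ (sub_ne_zero.2 (hz c))
    have h2 : Valued.v (w + HahnSeries.single (0 : ℤ) c) ≤ 1 := by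
      have : w + HahnSeries.single (0 : ℤ) c = (w + w) - (w - HahnSeries.single (0 : ℤ) c) := by ring
      rw [this]
      exact (Valuation.map_sub _ _ _).trans (max_le ((Valuation.map_add _ _ _).trans
        (max_le hw hw)) hc.le)
    have h3 : Valued.v ((w - HahnSeries.single (0 : ℤ) c) * (w + HahnSeries.single (0 : ℤ) c)) < 1 := by
      rw [map_mul]; exact mul_lt_one_of_lt_of_le hc h2
    have e : w ^ 2 - psiI φ a / psiI φ X ^ (2 * m) =
        HahnSeries.single (0 : ℤ) (c ^ 2 - z) +
        ((w - HahnSeries.single (0 : ℤ) c) * (w + HahnSeries.single (0 : ℤ) c) -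
          (psiI φ a / psiI φ X ^ (2 * m) - HahnSeries.single (0 : ℤ) z)) := by
      rw [← psi_C φ hφc, ← psi_C φ hφc, ← psi_C φ hφc, map_sub, map_sub, map_pow, map_pow]; ring
    rw [e, Valuation.map_add_eq_of_lt_left, h1]
    rw [h1]
    exact (Valuation.map_sub _ _ _).trans_lt (max_lt h3 hdiff)
  · intro s h
    rw [v_psi φ hφc hφX b hb0, map_pow] at h
    have hs : Valued.v s ≠ 0 := by
      intro h0; rw [h0] at h; simp at h
    have h1 := congrArg WithZero.log h
    rw [WithZero.log_pow, WithZero.log_exp] at h1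
    simp at h1
    obtain ⟨k, hk⟩ := hb
    omega
end infinity


section recip

variable {F : Type} [Field F] [Fintype F]

theorem ringChar_ne_two (hq : Odd (Fintype.card F)) : ringChar F ≠ 2 := by
  intro h
  apply two_ne_zero_F hq
  have := ringChar.Nat.cast_ringChar (R := F)
  rw [h] at this
  exact_mod_cast this

theorem isSquare_iff_norm (hq : Odd (Fintype.card F)) {K : Type} [Field K] [Finite K] [Algebra F K]
    (x : K) (hx : x ≠ 0) : IsSquare x ↔ IsSquare (Algebra.norm F x) := by
  have := Fintype.ofFinite K
  have hchar := ringChar_ne_two hq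
  have hcharK : ringChar K ≠ 2 := by rwa [← Algebra.ringChar_eq F K]
  have hN : Algebra.norm F x ≠ 0 := by rwa [Ne, Algebra.norm_eq_zero_iff]
  rw [FiniteField.isSquare_iff hcharK hx, FiniteField.isSquare_iff hchar hN,
    ← (algebraMap F K).injective.eq_iff, map_pow, map_one, FiniteField.algebraMap_norm_eq_pow,
    ← pow_mul, Nat.card_eq_fintype_card, Nat.card_eq_fintype_card]
  have hcard : Fintype.card K = Fintype.card F ^ Module.finrank F K := Module.card_eq_pow_finrank
  have hdvd : Fintype.card F - 1 ∣ Fintype.card K - 1 := by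
    rw [hcard]; simpa using Nat.sub_dvd_pow_sub_pow (Fintype.card F) 1 (Module.finrank F K)
  have hKodd : Odd (Fintype.card K) := by rw [hcard]; exact hq.pow
  have hc1 : 1 < Fintype.card F := Fintype.one_lt_card
  obtain ⟨m, hm⟩ := hdvd
  obtain ⟨c, hc⟩ := hq
  obtain ⟨k, hk⟩ := hKodd
  have : Fintype.card K / 2 = (Fintype.card K - 1) / (Fintype.card F - 1) * (Fintype.card F / 2) := by
    rw [hm, Nat.mul_div_cancel_left _ (by omega)]
    rw [hk, hc] at hm
    have h2 : (2 * k + 1) / 2 = k := by omega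
    have h3 : (2 * c + 1) / 2 = c := by omega
    rw [hk, hc, h2, h3]
    have : 2 * k = 2 * (m * c) := by
      have e1 : 2 * k + 1 - 1 = 2 * k := by omega
      have e2 : 2 * c + 1 - 1 = 2 * c := by omega
      rw [e1, e2] at hm; rw [hm]; ring
    omega
  rw [this]

theorem finite_adjoin (f : F[X]) (hf : f ≠ 0) : Finite (AdjoinRoot f) := finite_quot f hf

theorem norm_eq_roots (f g : F[X]) (hf : f.Monic) [hfi : Fact (Irreducible f)] :
    algebraMap F (AlgebraicClosure F) (Algebra.norm F (AdjoinRoot.mk f g)) =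
      (((f.map (algebraMap F (AlgebraicClosure F))).roots).map
        (eval · (g.map (algebraMap F (AlgebraicClosure F))))).prod := by
  classical
  have hfin := finite_adjoin f hf.ne_zero
  have : Module.Finite F (AdjoinRoot f) := Module.Finite.of_finite
  rw [Algebra.norm_eq_prod_embeddings F (AlgebraicClosure F)]
  have hnd : (f.map (algebraMap F (AlgebraicClosure F))).roots.Nodup :=
    nodup_roots ((PerfectField.separable_of_irreducible hfi.out).map)
  set S := (f.map (algebraMap F (AlgebraicClosure F))).roots with hS
  have hS' : (Multiset.map (eval · (g.map (algebraMap F (AlgebraicClosure F)))) S).prod =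
      ∏ x ∈ S.toFinset, eval x (g.map (algebraMap F (AlgebraicClosure F))) := by
    rw [Finset.prod, Multiset.toFinset_val, hnd.dedup]
  rw [hS']
  have hmem : ∀ x, x ∈ S.toFinset ↔ aeval x f = 0 := by
    intro x
    rw [Multiset.mem_toFinset, hS, mem_roots (hf.map _).ne_zero, IsRoot.def, eval_map_algebraMap]
  refine Finset.prod_bij (fun σ _ => σ (AdjoinRoot.root f)) ?_ ?_ ?_ ?_
  · intro σ _
    rw [hmem, aeval_algHom_apply, AdjoinRoot.aeval_eq, AdjoinRoot.mk_self, map_zero]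
  · intro σ _ τ _ h
    exact AdjoinRoot.algHom_ext h
  · intro x hx
    rw [hmem] at hx
    exact ⟨AdjoinRoot.liftAlgHom f (Algebra.ofId _ _) x hx, Finset.mem_univ _,
      AdjoinRoot.liftAlgHom_root _ _ _ _⟩
  · intro σ _
    rw [eval_map_algebraMap, aeval_algHom_apply, AdjoinRoot.aeval_eq]

theorem norm_recip (f g : F[X]) (hf : f.Monic) (hg : g.Monic) [Fact (Irreducible f)]
    [Fact (Irreducible g)] (hev : Even f.natDegree) :
    Algebra.norm F (AdjoinRoot.mk f g) = Algebra.norm F (AdjoinRoot.mk g f) := by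
  apply (algebraMap F (AlgebraicClosure F)).injective
  rw [norm_eq_roots f g hf, norm_eq_roots g f hg]
  set ι := algebraMap F (AlgebraicClosure F)
  have h1 := resultant_eq_prod_eval (f.map ι) (g.map ι) (g.map ι).natDegree le_rfl
    (IsAlgClosed.splits _)
  have h2 := resultant_eq_prod_eval (g.map ι) (f.map ι) (f.map ι).natDegree le_rfl
    (IsAlgClosed.splits _)
  simp only [natDegree_map] at h1 h2
  rw [resultant_comm, (hev.mul_right _).neg_one_pow, one_mul] at h1
  rw [h2] at h1
  simpa [hf.map ι |>.leadingCoeff, hg.map ι |>.leadingCoeff] using h1.symm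

theorem isSquare_recip (hq : Odd (Fintype.card F)) (f g : F[X]) (hf : f.Monic) (hg : g.Monic)
    [Fact (Irreducible f)] [Fact (Irreducible g)] (hev : Even f.natDegree)
    (h1 : AdjoinRoot.mk f g ≠ 0) (h2 : AdjoinRoot.mk g f ≠ 0) :
    IsSquare (AdjoinRoot.mk f g) ↔ IsSquare (AdjoinRoot.mk g f) := by
  have := finite_adjoin f hf.ne_zero
  have := finite_adjoin g hg.ne_zero
  rw [isSquare_iff_norm hq _ h1, isSquare_iff_norm hq _ h2, norm_recip f g hf hg hev]

theorem isSquare_const (hq : Odd (Fintype.card F)) (f : F[X]) (hf : f.Monic)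
    [Fact (Irreducible f)] (z : F) (hz : ¬ IsSquare z) :
    IsSquare (AdjoinRoot.mk f (Polynomial.C z)) ↔ Even f.natDegree := by
  have := finite_adjoin f hf.ne_zero
  have hz0 : z ≠ 0 := by rintro rfl; exact hz IsSquare.zero
  have hmk : AdjoinRoot.mk f (Polynomial.C z) = algebraMap F (AdjoinRoot f) z := rfl
  rw [isSquare_iff_norm hq _ (by rw [hmk]; simpa using hz0), hmk, Algebra.norm_algebraMap]
  have hfr : Module.finrank F (AdjoinRoot f) = f.natDegree := by
    rw [(AdjoinRoot.powerBasis hf.ne_zero).finrank, AdjoinRoot.powerBasis_dim]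
  rw [hfr]
  constructor
  · intro h
    by_contra ho
    rw [Nat.not_even_iff_odd] at ho
    obtain ⟨k, hk⟩ := ho
    rw [hk, _root_.pow_succ] at h
    apply hz
    have h2 : IsSquare ((z ^ k)⁻¹ ^ 2 ) := ⟨_, sq _⟩
    have := h.mul h2
    have e : z ^ (2 * k) * z * (z ^ k)⁻¹ ^ 2 = z := by
      field_simp; ring
    rwa [e] at this
  · intro h; exact h.isSquare_pow _

theorem mem_iff_mk (f g : F[X]) : g ∈ Ideal.span {f} ↔ AdjoinRoot.mk f g = 0 := by
  rw [AdjoinRoot.mk_eq_zero, Ideal.mem_span_singleton]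

theorem isSquare_iff_mem (f g : F[X]) :
    IsSquare (AdjoinRoot.mk f g) ↔ ∃ w : F[X], w ^ 2 - g ∈ Ideal.span {f} := by
  constructor
  · rintro ⟨r, hr⟩
    obtain ⟨w, rfl⟩ := AdjoinRoot.mk_surjective r
    exact ⟨w, by rw [mem_iff_mk, map_sub, hr, map_pow]; ring⟩
  · rintro ⟨w, hw⟩
    rw [mem_iff_mk, map_sub, map_pow, sub_eq_zero] at hw
    exact ⟨AdjoinRoot.mk f w, by rw [← hw]; ring⟩

theorem isSquare_mul_nonsquares {K : Type} [Field K] [Finite K] (a b : K)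
    (ha : ¬ IsSquare a) (hb : ¬ IsSquare b) : IsSquare (a * b) := by
  classical
  have := Fintype.ofFinite K
  have ha0 : a ≠ 0 := by rintro rfl; exact ha IsSquare.zero
  have hb0 : b ≠ 0 := by rintro rfl; exact hb IsSquare.zero
  rw [← quadraticChar_neg_one_iff_not_isSquare] at ha hb
  rw [← quadraticChar_one_iff_isSquare (mul_ne_zero ha0 hb0), map_mul, ha, hb]; rfl

end recip

section dirichlet

variable {F : Type} [Field F] [Fintype F]

theorem finite_monic (n : ℕ) : {e : F[X] | e.Monic ∧ e.natDegree = n}.Finite := by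
  have : Finite (Polynomial.degreeLT F n) :=
    Finite.of_equiv _ (Polynomial.degreeLTEquiv F n).toEquiv.symm
  have : Finite {p : F[X] // p.Monic ∧ p.natDegree = n} :=
    Finite.of_equiv _ (Polynomial.monicEquivDegreeLT n).symm
  exact Set.finite_coe_iff.1 this

/-- Monic polynomials of degree `n`. -/
def monM (F : Type) [Field F] [Fintype F] (n : ℕ) : Finset F[X] := (finite_monic (F := F) n).toFinset

theorem mem_monM (n : ℕ) (e : F[X]) : e ∈ monM F n ↔ e.Monic ∧ e.natDegree = n := by
  simp [monM]

theorem card_monM (n : ℕ) : (monM F n).card = Fintype.card F ^ n := by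
  have h1 : Nat.card {p : F[X] // p.Monic ∧ p.natDegree = n} = Fintype.card F ^ n := by
    rw [Nat.card_congr (Polynomial.monicEquivDegreeLT n),
      Nat.card_congr (Polynomial.degreeLTEquiv F n).toEquiv]
    simp [Nat.card_eq_fintype_card]
  rw [← h1, monM, ← Set.ncard_eq_toFinset_card _ (finite_monic n)]
  rfl

open Classical in
/-- Monic divisors. -/
def monD (d : F[X]) : Finset F[X] :=
  ((Finset.range (d.natDegree + 1)).biUnion (monM F)).filter (· ∣ d)

theorem mem_monD (d : F[X]) (hd : d ≠ 0) (e : F[X]) : e ∈ monD d ↔ e.Monic ∧ e ∣ d := by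
  classical
  simp only [monD, Finset.mem_filter, Finset.mem_biUnion, Finset.mem_range, mem_monM]
  constructor
  · rintro ⟨⟨j, hj, h, _⟩, h2⟩; exact ⟨h, h2⟩
  · rintro ⟨h, h2⟩
    exact ⟨⟨_, Nat.lt_succ_of_le (natDegree_le_of_dvd h2 hd), h, rfl⟩, h2⟩

variable (χ : F[X] → ℤ)

/-- Divisor sum. -/
def rsum (d : F[X]) : ℤ := ∑ e ∈ monD d, χ e

theorem rsum_mul (hmul : ∀ a b : F[X], a.Monic → b.Monic → χ (a * b) = χ a * χ b)
    (h1 : χ 1 = 1) (p m : F[X]) (hp : Irreducible p) (hpm : p.Monic) (hm : m.Monic)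
    (hpd : ¬ p ∣ m) (k : ℕ) :
    rsum χ (p ^ k * m) = (∑ i ∈ Finset.range (k + 1), χ p ^ i) * rsum χ m := by
  have hpow : ∀ i, χ (p ^ i) = χ p ^ i := by
    intro i
    induction i with
    | zero => simpa using h1
    | succ i ih => rw [_root_.pow_succ, hmul _ _ (hpm.pow i) hpm, ih, _root_.pow_succ]
  have hp0 : p ≠ 0 := hpm.ne_zero
  have hne : p ^ k * m ≠ 0 := ((hpm.pow k).mul hm).ne_zero
  unfold rsum
  rw [Finset.sum_mul_sum, ← Finset.sum_product']
  symm
  refine Finset.sum_bij (fun x _ => p ^ x.1 * x.2) ?_ ?_ ?_ ?_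
  · rintro ⟨i, e⟩ h
    simp only [Finset.mem_product, Finset.mem_range, mem_monD _ hm.ne_zero] at h
    rw [mem_monD _ hne]
    exact ⟨(hpm.pow i).mul h.2.1, mul_dvd_mul (pow_dvd_pow _ (by omega)) h.2.2⟩
  · rintro ⟨i, e⟩ h ⟨j, e'⟩ h' heq
    simp only [Finset.mem_product, Finset.mem_range, mem_monD _ hm.ne_zero] at h h'
    simp only at heq
    have aux : ∀ (i j : ℕ) (e e' : F[X]), e ∣ m → p ^ i * e = p ^ j * e' → ¬ i < j := by
      intro i j e e' he heq hij
      obtain ⟨s, rfl⟩ := Nat.exists_eq_add_of_lt hij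
      apply hpd
      refine dvd_trans ?_ he
      have : e = p ^ (s + 1) * e' := by
        apply mul_left_cancel₀ (pow_ne_zero i hp0)
        rw [heq]; ring
      rw [this, _root_.pow_succ]
      exact ⟨p ^ s * e', by ring⟩
    have hij : i = j := by
      have := aux i j e e' h.2.2 heq
      have := aux j i e' e h'.2.2 heq.symm
      omega
    subst hij
    simp [mul_left_cancel₀ (pow_ne_zero i hp0) heq]
  · intro e he
    rw [mem_monD _ hne] at he
    obtain ⟨hem, hed⟩ := he
    obtain ⟨a, b, ha, hb, rfl⟩ := exists_dvd_and_dvd_of_dvd_mul hed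
    obtain ⟨i, hi, hai⟩ := (dvd_prime_pow hp.prime k).1 ha
    obtain ⟨u, hu⟩ := hai.symm
    have hab : a * b = p ^ i * (u * b) := by rw [← hu]; ring
    refine ⟨(i, u * b), ?_, hab.symm⟩
    simp only [Finset.mem_product, Finset.mem_range, mem_monD _ hm.ne_zero]
    refine ⟨by omega, ?_, ?_⟩
    · rw [hab] at hem; exact (hpm.pow i).of_mul_monic_left hem
    · exact (Units.mul_left_dvd).2 hb
  · rintro ⟨i, e⟩ h
    simp only [Finset.mem_product, Finset.mem_range, mem_monD _ hm.ne_zero] at h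
    simp only
    rw [hmul _ _ (hpm.pow i) h.2.1, hpow]

theorem rsum_one (h1 : χ 1 = 1) : rsum χ 1 = 1 := by
  have : monD (1 : F[X]) = {1} := by
    ext e
    rw [mem_monD _ one_ne_zero, Finset.mem_singleton]
    constructor
    · rintro ⟨h, h2⟩; exact h.isUnit_iff.1 (isUnit_of_dvd_one h2)
    · rintro rfl; exact ⟨monic_one, dvd_refl _⟩
  simp [rsum, this, h1]

theorem geom_nonneg (s : ℤ) (hs : s = 0 ∨ s = 1 ∨ s = -1) (k : ℕ) :
    0 ≤ ∑ i ∈ Finset.range (k + 1), s ^ i := by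
  rcases hs with rfl | rfl | rfl
  · simp
  · simp; positivity
  · rw [neg_one_geom_sum]; split_ifs <;> simp

theorem rsum_props (hmul : ∀ a b : F[X], a.Monic → b.Monic → χ (a * b) = χ a * χ b)
    (h1 : χ 1 = 1) (hval : ∀ e, χ e = 0 ∨ χ e = 1 ∨ χ e = -1)
    (hodd : ∀ p : F[X], p.Monic → Irreducible p → Odd p.natDegree → χ p = -1)
    (n : ℕ) : ∀ d : F[X], d.Monic → d.natDegree = n →
      0 ≤ rsum χ d ∧ (Odd d.natDegree → rsum χ d = 0) := by
  induction n using Nat.strong_induction_on with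
  | _ n ih =>
  intro d hd hdn
  by_cases hd1 : d = 1
  · subst hd1; rw [rsum_one χ h1]; simp
  obtain ⟨p, hpm, hp, hpd⟩ := Polynomial.exists_monic_irreducible_factor d
    (fun h => hd1 (hd.isUnit_iff.1 h))
  obtain ⟨k, m, hpm', hdm⟩ := 
    (FiniteMultiplicity.of_not_isUnit hp.not_isUnit hd.ne_zero : FiniteMultiplicity p d).exists_eq_pow_mul_and_not_dvd
     |> fun ⟨c, h1, h2⟩ => (⟨multiplicity p d, c, h2, h1⟩ : ∃ k m, ¬ p ∣ m ∧ d = p ^ k * m)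
  have hm : m.Monic := by rw [hdm] at hd; exact (hpm.pow k).of_mul_monic_left hd
  have hk : k ≠ 0 := by
    rintro rfl; apply hpm'; simpa [hdm] using hpd
  have hdeg : d.natDegree = k * p.natDegree + m.natDegree := by
    rw [hdm, (hpm.pow k).natDegree_mul hm, hpm.natDegree_pow]
  have hpos := hp.natDegree_pos
  have hlt : m.natDegree < n := by
    have : 0 < k * p.natDegree := Nat.mul_pos (Nat.pos_of_ne_zero hk) hpos
    omega
  obtain ⟨ih1, ih2⟩ := ih _ hlt m hm rfl
  have hr := rsum_mul χ hmul h1 p m hp hpm hm hpm' k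
  rw [← hdm] at hr
  rw [hr]
  refine ⟨mul_nonneg (geom_nonneg _ (hval p) k) ih1, fun ho => ?_⟩
  rw [hdeg, Nat.odd_add] at ho
  by_cases hmo : Odd m.natDegree
  · rw [ih2 hmo, mul_zero]
  · have h2 := ho.2 (Nat.not_odd_iff_even.1 hmo)
    rw [Nat.odd_mul] at h2
    rw [hodd p hpm hp h2.2, neg_one_geom_sum, if_pos, zero_mul]
    exact h2.1.add_one

theorem card_dvd (n : ℕ) (e : F[X]) (he : e.Monic) (hn : e.natDegree ≤ n) [DecidablePred (e ∣ ·)] :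
    ((monM F n).filter (e ∣ ·)).card = Fintype.card F ^ (n - e.natDegree) := by
  classical
  rw [← card_monM, ← Finset.card_image_of_injective (monM F (n - e.natDegree))
    (mul_right_injective₀ he.ne_zero)]
  congr 1
  ext d
  simp only [Finset.mem_filter, Finset.mem_image, mem_monM]
  constructor
  · rintro ⟨⟨h, h2⟩, g, rfl⟩
    have hg := he.of_mul_monic_left h
    rw [he.natDegree_mul hg] at h2
    exact ⟨g, ⟨hg, by omega⟩, rfl⟩
  · rintro ⟨g, ⟨hg, h2⟩, rfl⟩
    exact ⟨⟨he.mul hg, by rw [he.natDegree_mul hg]; omega⟩, dvd_mul_right _ _⟩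

theorem sum_rsum (n : ℕ) : ∑ d ∈ monM F n, rsum χ d =
    ∑ j ∈ Finset.range (n + 1), (Fintype.card F : ℤ) ^ (n - j) * ∑ e ∈ monM F j, χ e := by
  classical
  have h1 : ∀ d ∈ monM F n, rsum χ d =
      ∑ j ∈ Finset.range (n + 1), ∑ e ∈ monM F j, if e ∣ d then χ e else 0 := by
    intro d hd
    rw [mem_monM] at hd
    unfold rsum monD
    rw [Finset.sum_filter, Finset.sum_biUnion, hd.2]
    · intro i _ j _ hij
      rw [Function.onFun, Finset.disjoint_left]
      intro a ha hb
      rw [mem_monM] at ha hb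
      exact hij (ha.2.symm.trans hb.2)
  rw [Finset.sum_congr rfl h1, Finset.sum_comm]
  refine Finset.sum_congr rfl fun j hj => ?_
  rw [Finset.sum_comm, Finset.mul_sum]
  refine Finset.sum_congr rfl fun e he => ?_
  rw [mem_monM] at he
  rw [Finset.mem_range] at hj
  rw [← Finset.sum_filter, Finset.sum_const, card_dvd n e he.1 (by omega), he.2]
  simp

theorem exists_odd (hmul : ∀ a b : F[X], a.Monic → b.Monic → χ (a * b) = χ a * χ b)
    (h1 : χ 1 = 1) (hval : ∀ e, χ e = 0 ∨ χ e = 1 ∨ χ e = -1)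
    (N : ℕ) (hB : ∀ j, N ≤ j → ∑ e ∈ monM F j, χ e = 0) :
    ∃ p : F[X], p.Monic ∧ Irreducible p ∧ Odd p.natDegree ∧ χ p ≠ -1 := by
  by_contra hcon
  have hodd : ∀ p : F[X], p.Monic → Irreducible p → Odd p.natDegree → χ p = -1 := by
    intro p a b c
    by_contra hne
    exact hcon ⟨p, a, b, c, hne⟩
  have key := rsum_props χ hmul h1 hval hodd
  have hR : ∑ d ∈ monM F (2 * N + 1), rsum χ d =
      Fintype.card F * ∑ d ∈ monM F (2 * N), rsum χ d := by
    rw [sum_rsum, sum_rsum, Finset.sum_range_succ, hB _ (by omega), mul_zero, add_zero,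
      Finset.mul_sum]
    refine Finset.sum_congr rfl fun j hj => ?_
    rw [Finset.mem_range] at hj
    rw [show 2 * N + 1 - j = (2 * N - j) + 1 by omega, _root_.pow_succ]
    ring
  have hz : ∑ d ∈ monM F (2 * N + 1), rsum χ d = 0 := by
    refine Finset.sum_eq_zero fun d hd => ?_
    rw [mem_monM] at hd
    exact (key _ d hd.1 rfl).2 (by rw [hd.2]; exact ⟨N, rfl⟩)
  have hpos : 0 < ∑ d ∈ monM F (2 * N), rsum χ d := by
    refine Finset.sum_pos' (fun d hd => ?_) ⟨X ^ (2 * N), ?_, ?_⟩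
    · rw [mem_monM] at hd
      exact (key _ d hd.1 rfl).1
    · rw [mem_monM]; exact ⟨monic_X_pow _, natDegree_X_pow _⟩
    · have := rsum_mul χ hmul h1 X 1 irreducible_X monic_X monic_one
        (fun h => irreducible_X.not_isUnit (isUnit_of_dvd_one h)) (2 * N)
      rw [mul_one, rsum_one χ h1, mul_one] at this
      rw [this, hodd X monic_X irreducible_X (by simp), neg_one_geom_sum, if_neg]
      · simp
      · simp [parity_simps]
  rw [hz] at hR
  have : (0 : ℤ) < Fintype.card F := by exact_mod_cast Fintype.card_pos
  have := mul_pos this hpos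
  omega

theorem shift_monM (j : ℕ) (c e : F[X]) (hc : c.degree < j) (he : e ∈ monM F j) :
    e + c ∈ monM F j := by
  rw [mem_monM] at *
  have hd : c.degree < e.degree := by
    rw [degree_eq_natDegree he.1.ne_zero, he.2]; exact hc
  exact ⟨he.1.add_of_left hd, by rw [natDegree_add_eq_left_of_degree_lt hd, he.2]⟩

theorem sum_char_zero (f : F[X]) (hf : f.Monic) (ψ : AdjoinRoot f → ℤ)
    [Fintype (AdjoinRoot f)] (hψ : ∑ a, ψ a = 0) (j : ℕ) (hj : f.natDegree ≤ j) :
    ∑ e ∈ monM F j, ψ (AdjoinRoot.mk f e) = 0 := by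
  have h1 : ∀ a : AdjoinRoot f, ∑ e ∈ monM F j, ψ (AdjoinRoot.mk f e + a) =
      ∑ e ∈ monM F j, ψ (AdjoinRoot.mk f e) := by
    intro a
    obtain ⟨g, rfl⟩ := AdjoinRoot.mk_surjective a
    have hmk : AdjoinRoot.mk f g = AdjoinRoot.mk f (g %ₘ f) := by
      conv_lhs => rw [← modByMonic_add_div g f]
      simp
    rw [hmk]
    set c := g %ₘ f
    have hc : c.degree < j := lt_of_lt_of_le (degree_modByMonic_lt g hf) (by
      rw [degree_eq_natDegree hf.ne_zero]; exact_mod_cast hj)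
    refine Finset.sum_equiv (Equiv.addRight c) (fun e => ?_) (fun e _ => ?_)
    · refine ⟨fun h => shift_monM j c e hc h, fun h => ?_⟩
      have := shift_monM j (-c) _ (by rwa [degree_neg]) h
      simpa using this
    · simp
  have h2 : ∑ a : AdjoinRoot f, ∑ e ∈ monM F j, ψ (AdjoinRoot.mk f e + a) = 0 := by
    rw [Finset.sum_comm]
    refine Finset.sum_eq_zero fun e _ => ?_
    rw [← hψ]
    exact Equiv.sum_comp (Equiv.addLeft (AdjoinRoot.mk f e)) ψ
  rw [Finset.sum_congr rfl (fun a _ => h1 a), Finset.sum_const, smul_eq_zero] at h2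
  rcases h2 with h2 | h2
  · have : Nonempty (AdjoinRoot f) := ⟨0⟩
    rw [Finset.card_univ] at h2
    exact absurd h2 Fintype.card_ne_zero
  · exact h2

end dirichlet

theorem quat_splits_swap (K : Type) [Field K] (a b : K) (h : QuatSplits K a b) :
    QuatSplits K b a := by
  obtain ⟨e⟩ := h
  let B : QuaternionAlgebra.Basis ℍ[K, a, b] b 0 a :=
    { i := ⟨0, 0, 1, 0⟩
      j := ⟨0, 1, 0, 0⟩
      k := ⟨0, 0, 0, -1⟩
      i_mul_i := by ext <;> simp
      j_mul_j := by ext <;> simp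
      i_mul_j := by ext <;> simp
      j_mul_i := by ext <;> simp }
  have hinj : Function.Injective B.liftHom := by
    rw [injective_iff_map_eq_zero]
    intro q hq
    have e1 := congrArg QuaternionAlgebra.re hq
    have e2 := congrArg QuaternionAlgebra.imI hq
    have e3 := congrArg QuaternionAlgebra.imJ hq
    have e4 := congrArg QuaternionAlgebra.imK hq
    simp [B, QuaternionAlgebra.Basis.lift] at e1 e2 e3 e4
    ext <;> simp [*]
  have hfin : Module.finrank K ℍ[K, b, a] = Module.finrank K ℍ[K, a, b] := by
    rw [QuaternionAlgebra.finrank_eq_four, QuaternionAlgebra.finrank_eq_four]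
  have hbij : Function.Bijective B.liftHom :=
    ⟨hinj, (LinearMap.injective_iff_surjective_of_finrank_eq_finrank
      (f := B.liftHom.toLinearMap) hfin).1 hinj⟩
  exact ⟨(AlgEquiv.ofBijective B.liftHom hbij).trans e⟩

section final

variable {F : Type} [Field F] [Fintype F]

theorem asIdeal_of_mem (p : HeightOneSpectrum F[X]) (f : F[X]) (hf : Irreducible f)
    (h : f ∈ p.asIdeal) : p.asIdeal = Ideal.span {f} := by
  have := PrincipalIdealRing.isMaximal_of_irreducible hf
  exact (this.eq_of_le p.isPrime.ne_top ((Ideal.span_singleton_le_iff_mem _).2 h)).symm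

theorem C_notMem (p : HeightOneSpectrum F[X]) (z : F) (hz : z ≠ 0) :
    Polynomial.C z ∉ p.asIdeal := fun h =>
  p.isPrime.ne_top (Ideal.eq_top_of_isUnit_mem _ h (isUnit_C.2 (isUnit_iff_ne_zero.2 hz)))

theorem exists_d (hq : Odd (Fintype.card F)) (f : F[X]) (hf : f.Monic) (hfi : Irreducible f)
    (hev : Even f.natDegree) : ∃ d : F[X], d.Monic ∧ Irreducible d ∧ Odd d.natDegree ∧
      ¬ IsSquare (AdjoinRoot.mk f d) := by
  classical
  have : Fact (Irreducible f) := ⟨hfi⟩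
  have := finite_adjoin f hf.ne_zero
  have := Fintype.ofFinite (AdjoinRoot f)
  have hchar : ringChar (AdjoinRoot f) ≠ 2 := by
    rw [← Algebra.ringChar_eq F (AdjoinRoot f)]; exact ringChar_ne_two hq
  have hB0 := quadraticChar_sum_zero hchar
  obtain ⟨d, hd, hdi, hdo, hne⟩ := exists_odd
    (fun e : F[X] => (-1) ^ e.natDegree * quadraticChar (AdjoinRoot f) (AdjoinRoot.mk f e))
    (by
      intro a b ha hb
      simp only [ha.natDegree_mul hb, map_mul, _root_.pow_add]
      ring) (by simp)
    (by
      intro e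
      rcases neg_one_pow_eq_or ℤ e.natDegree with h | h <;> 
      · by_cases h0 : AdjoinRoot.mk f e = 0
        · simp [h0]
        · rcases quadraticChar_dichotomy h0 with h1 | h1 <;> simp [h, h1])
    f.natDegree
    (by
      intro j hj
      have h := sum_char_zero f hf (fun a => quadraticChar (AdjoinRoot f) a) hB0 j hj
      rw [Finset.sum_congr rfl (g := fun e => (-1) ^ j *
        quadraticChar (AdjoinRoot f) (AdjoinRoot.mk f e)), ← Finset.mul_sum, h, mul_zero]
      intro e he
      rw [mem_monM] at he
      rw [he.2])
  refine ⟨d, hd, hdi, hdo, fun hsq => hne ?_⟩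
  have h0 : AdjoinRoot.mk f d ≠ 0 := by
    rw [Ne, AdjoinRoot.mk_eq_zero]
    intro hdvd
    have := eq_of_monic_of_associated hf hd ((hfi.dvd_irreducible_iff_associated hdi).1 hdvd)
    rw [this, ← Nat.not_odd_iff_even] at hev
    exact hev hdo
  rw [hdo.neg_one_pow, (quadraticChar_one_iff_isSquare h0).2 hsq]; rfl

end final
/-- For each monic irreducible `f` there are `a, b` with `H(a,b)` nonsplit exactly at `f`, infinity. -/
theorem stmt18 (F : Type) [Field F] [Fintype F] (hq : Odd (Fintype.card F))
    (φ : RatFunc F →+* LaurentSeries F)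
    (hφc : ∀ x : F, φ (algebraMap F (RatFunc F) x) = HahnSeries.single (0 : ℤ) x)
    (hφX : φ RatFunc.X * HahnSeries.single (1 : ℤ) (1 : F) = 1)
    (f : Polynomial F) (hfm : f.Monic) (hfi : Irreducible f) :
    ∃ a b : RatFunc F,
      ¬ QuatSplits (LaurentSeries F) (φ a) (φ b) ∧
      ∀ p : HeightOneSpectrum (Polynomial F),
        (¬ QuatSplits (p.adicCompletion (RatFunc F))
            (algebraMap (RatFunc F) (p.adicCompletion (RatFunc F)) a)
            (algebraMap (RatFunc F) (p.adicCompletion (RatFunc F)) b)) ↔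
          p.asIdeal = Ideal.span {f} := by
  classical
  have h2 := ringChar_ne_two hq
  obtain ⟨z, hz⟩ := FiniteField.exists_nonsquare h2
  have hz0 : z ≠ 0 := by rintro rfl; exact hz IsSquare.zero
  have hz' : ∀ x : F, x ^ 2 ≠ z := fun x hx => hz ⟨x, by rw [← hx, sq]⟩
  have hF : Fact (Irreducible f) := ⟨hfi⟩
  rcases Nat.even_or_odd f.natDegree with hev | hodd
  · obtain ⟨d, hd, hdi, hdo, hns⟩ := exists_d hq f hfm hfi hev
    have hD : Fact (Irreducible d) := ⟨hdi⟩
    have hfd : ¬ Associated f d := by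
      intro h
      rw [eq_of_monic_of_associated hfm hd h, ← Nat.not_odd_iff_even] at hev
      exact hev hdo
    have h0 : AdjoinRoot.mk f d ≠ 0 := by
      rw [Ne, AdjoinRoot.mk_eq_zero, hfi.dvd_irreducible_iff_associated hdi]
      exact hfd
    have h0' : AdjoinRoot.mk d f ≠ 0 := by
      rw [Ne, AdjoinRoot.mk_eq_zero, hdi.dvd_irreducible_iff_associated hfi]
      exact fun h => hfd h.symm
    refine ⟨algebraMap F[X] (RatFunc F) (Polynomial.C z * f),
      algebraMap F[X] (RatFunc F) (Polynomial.C z * d), ?_, fun p => ⟨fun h => ?_, fun h => ?_⟩⟩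
    · exact nonsplit_inf φ hφc hφX z hz' (Polynomial.C z * f) (Polynomial.C z * d)
        (by simp [hfm.leadingCoeff]) (by rwa [natDegree_C_mul hz0]) (by rwa [natDegree_C_mul hz0])
    · by_contra hp
      apply h
      have hf : f ∉ p.asIdeal := fun hm => hp (asIdeal_of_mem p f hfi hm)
      have hzf : Polynomial.C z * f ∉ p.asIdeal := fun hm =>
        (p.isPrime.mem_or_mem hm).elim (C_notMem p z hz0) hf
      by_cases hdp : d ∈ p.asIdeal
      · have hpd := asIdeal_of_mem p d hdi hdp
        have hfin := finite_adjoin d hd.ne_zero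
        have hsq : IsSquare (AdjoinRoot.mk d (Polynomial.C z * f)) := by
          rw [map_mul]
          apply isSquare_mul_nonsquares
          · rw [isSquare_const hq d hd z hz, Nat.not_even_iff_odd]; exact hdo
          · rwa [← isSquare_recip hq f d hfm hd hev h0 h0']
        rw [isSquare_iff_mem] at hsq
        obtain ⟨w, hw⟩ := hsq
        refine splits_of_sq p hq (Polynomial.C z * f) (Polynomial.C z * d) w hzf
          (mul_ne_zero (by simpa using hz0) hd.ne_zero) ?_
        rw [hpd, ← neg_mem_iff, neg_sub]; exact hw
      · exact splits_of_units p hq (Polynomial.C z * f) (Polynomial.C z * d) hzf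
          (fun hm => (p.isPrime.mem_or_mem hm).elim (C_notMem p z hz0) hdp)
    · intro hs
      have hs' := quat_splits_swap _ _ _ hs
      refine nonsplit_local p f (Polynomial.C z) (Polynomial.C z * d) hfm.ne_zero h
        (C_notMem p z hz0) ?_ hs'
      intro w hw
      have hsq : IsSquare (AdjoinRoot.mk f (Polynomial.C z * d)) :=
        (isSquare_iff_mem _ _).2 ⟨w, by rwa [← h]⟩
      apply hns
      have hzs := (isSquare_const hq f hfm z hz).2 hev
      have hzne : AdjoinRoot.mk f (Polynomial.C z) ≠ 0 := by
        rw [Ne, ← mem_iff_mk, ← h]; exact C_notMem p z hz0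
      have := hsq.div hzs
      rwa [map_mul, mul_div_cancel_left₀ _ hzne] at this
  · refine ⟨algebraMap F[X] (RatFunc F) (Polynomial.C z),
      algebraMap F[X] (RatFunc F) f, ?_, fun p => ⟨fun h => ?_, fun h => ?_⟩⟩
    · exact nonsplit_inf φ hφc hφX z hz' (Polynomial.C z) f (by simp) (by simp) hodd
    · by_contra hp
      apply h
      have hf : f ∉ p.asIdeal := fun hm => hp (asIdeal_of_mem p f hfi hm)
      exact splits_of_units p hq (Polynomial.C z) f (C_notMem p z hz0) hf
    · have := nonsplit_local p f 1 (Polynomial.C z) hfm.ne_zero h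
        (fun hm => p.isPrime.ne_top ((Ideal.eq_top_iff_one _).2 hm)) (by
          intro w hw
          rw [h] at hw
          have := (isSquare_const hq f hfm z hz).1 ((isSquare_iff_mem _ _).2 ⟨w, hw⟩)
          rw [← Nat.not_odd_iff_even] at this
          exact this hodd)
      rw [one_mul] at this
      exact this
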